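/- arXiv:1703.10540 — 2 statements merged into one kernel-verified Lean document; each statement's English description precedes it below -/
import Mathlib

section
/- Let H be Hall's universal group. For every countable locally finite group G there exist an injective group homomorphism e : G → H and an injective group homomorphism Φ : Aut(G) → Aut(H) such that Φ(f)(e(x)) = e(f(x)) for every f ∈ Aut(G) and every x ∈ G (i.e. every automorphism of the copy e(G) of G inside H extends to an automorphism of H, in such a way that the assignment f ↦ Φ(f) is a group embedding of Aut(G) into Aut(H)). -/
universe u v

/-- Every finitely generated subgroup is finite. -/
def LocallyFiniteGroup (G : Type*) [Group G] : Prop :=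
  ∀ s : Set G, s.Finite → (Subgroup.closure s : Set G).Finite

/-- `R` is the graph of an isomorphism between finite subgroups of `G` and `M`. -/
structure IsFinitePartialIso {G M : Type*} [Group G] [Group M] (R : Subgroup (G × M)) : Prop where
  finite : (R : Set (G × M)).Finite
  fst_inj : ∀ p ∈ R, p.1 = 1 → p.2 = 1
  snd_inj : ∀ p ∈ R, p.2 = 1 → p.1 = 1

theorem LocallyFiniteGroup.prod {G M : Type*} [Group G] [Group M] (hG : LocallyFiniteGroup G)
    (hM : LocallyFiniteGroup M) : LocallyFiniteGroup (G × M) := by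
  intro s hs
  refine ((hG _ (hs.image Prod.fst)).prod (hM _ (hs.image Prod.snd))).subset ?_
  have : Subgroup.closure s ≤ (Subgroup.closure (Prod.fst '' s)).prod
      (Subgroup.closure (Prod.snd '' s)) := by
    rw [Subgroup.closure_le]
    intro p hp
    exact ⟨Subgroup.subset_closure ⟨p, hp, rfl⟩, Subgroup.subset_closure ⟨p, hp, rfl⟩⟩
  exact this

theorem LocallyFiniteGroup.pi_const {Z Q : Type*} [Group Q] [Finite Q] :
    LocallyFiniteGroup (Z → Q) := by
  intro s hs
  have := hs.to_subtype
  let ev : ((s → Q) → Q) →* (Z → Q) :=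
    { toFun := fun g z ↦ g fun i ↦ i.1 z
      map_one' := rfl
      map_mul' := fun _ _ ↦ rfl }
  refine (Set.finite_range ev).subset ?_
  rw [← MonoidHom.coe_range, SetLike.coe_subset_coe, Subgroup.closure_le]
  exact fun i hi ↦ ⟨fun t ↦ t ⟨i, hi⟩, rfl⟩

theorem finite_closure_of_preserves_fst {Y Z N : Type*} [Finite N] (e : Y ≃ Z × N)
    {s : Set (Equiv.Perm Y)} (hs : s.Finite) (h : ∀ π ∈ s, ∀ y, (e (π y)).1 = (e y).1) :
    (Subgroup.closure s : Set (Equiv.Perm Y)).Finite := by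
  let Θ : (Z → Equiv.Perm N) →* Equiv.Perm Y :=
    { toFun := fun f ↦ e.symm.permCongr (Equiv.prodCongrRight f)
      map_one' := by ext y; exact e.symm_apply_apply y
      map_mul' := fun f g ↦ by ext; simp; rfl }
  have hΘ : Function.Injective Θ := by
    intro f g hfg
    funext z
    ext n
    have := congrArg (fun π : Equiv.Perm Y ↦ (e (π (e.symm (z, n)))).2) hfg
    simpa [Θ] using this
  have hsub : s ⊆ Set.range Θ := by
    intro π hπ
    have h1 : ∀ z n, (e (π (e.symm (z, n)))).1 = z := fun z n ↦ by simp [h π hπ]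
    have h2 : ∀ z n, (e (π.symm (e.symm (z, n)))).1 = z := fun z n ↦ by
      rw [← h π hπ]; simp
    have h3 : ∀ z n, e.symm (z, (e (π (e.symm (z, n)))).2) = π (e.symm (z, n)) := fun z n ↦ by
      rw [Equiv.symm_apply_eq]; exact Prod.ext (h1 z n).symm rfl
    have h4 : ∀ z n, e.symm (z, (e (π.symm (e.symm (z, n)))).2) = π.symm (e.symm (z, n)) :=
      fun z n ↦ by rw [Equiv.symm_apply_eq]; exact Prod.ext (h2 z n).symm rfl
    refine ⟨fun z ↦ ⟨fun n ↦ (e (π (e.symm (z, n)))).2, fun n ↦ (e (π.symm (e.symm (z, n)))).2,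
      fun n ↦ ?_, fun n ↦ ?_⟩, ?_⟩
    · simp [h3]
    · simp [h4]
    · ext y
      obtain ⟨⟨z, n⟩, rfl⟩ := e.symm.surjective y
      simp [Θ, h3]
  have : s = Θ '' (Θ ⁻¹' s) := (Set.image_preimage_eq_of_subset hsub).symm
  rw [this, ← MonoidHom.map_closure, Subgroup.coe_map]
  exact (LocallyFiniteGroup.pi_const _ (hs.preimage hΘ.injOn)).image _

/-- The permutations of `C × G` that fix the first coordinate and move the second one within its
left coset of `F`. -/
def MovesWithin {C G : Type*} [Group G] (F : Subgroup G) (π : Equiv.Perm (C × G)) : Prop :=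
  ∀ x, (π x).1 = x.1 ∧ x.2⁻¹ * (π x).2 ∈ F

theorem MovesWithin.mono {C G : Type*} [Group G] {F F' : Subgroup G} (h : F ≤ F')
    {π : Equiv.Perm (C × G)} (hπ : MovesWithin F π) : MovesWithin F' π :=
  fun x ↦ ⟨(hπ x).1, h (hπ x).2⟩

theorem exists_equiv_prod_of_injective {G : Type u} {R : Type*} [Group G] [Group R] (i : R →* G)
    (hi : Function.Injective i) :
    ∃ (Q : Type u) (e : Q × R ≃ G), ∀ q r r', e (q, r * r') = e (q, r) * i r' := by
  refine ⟨G ⧸ i.range, Equiv.ofBijective (fun p ↦ p.1.out * i p.2) ⟨?_, fun x ↦ ?_⟩,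
    fun q r r' ↦ ?_⟩
  · rintro ⟨q, r⟩ ⟨q', r'⟩ h
    have hq : q = q' := by
      have := congrArg (fun x : G ↦ (x : G ⧸ i.range)) h
      simpa [QuotientGroup.mk_mul_of_mem _ (MonoidHom.mem_range.2 ⟨_, rfl⟩ : i _ ∈ i.range)] using this
    subst hq
    exact Prod.ext rfl (hi (mul_left_cancel h))
  · obtain ⟨r, hr⟩ : (x : G ⧸ i.range).out⁻¹ * x ∈ i.range := by
      rw [← QuotientGroup.eq, QuotientGroup.out_eq']
    exact ⟨(x, r), by simp [hr]⟩
  · change _ * i (r * r') = _ * i r * i r'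
    rw [map_mul, mul_assoc]

theorem finite_closure_of_movesWithin {C G : Type*} [Group G] {F : Subgroup G}
    (hF : (F : Set G).Finite) {s : Set (Equiv.Perm (C × G))} (hs : s.Finite)
    (h : ∀ π ∈ s, MovesWithin F π) : (Subgroup.closure s : Set (Equiv.Perm (C × G))).Finite := by
  obtain ⟨Q, e, he⟩ := exists_equiv_prod_of_injective F.subtype F.subtype_injective
  have : Finite F := hF
  refine finite_closure_of_preserves_fst
    (((Equiv.refl C).prodCongr e.symm).trans (Equiv.prodAssoc C Q F).symm) hs ?_
  intro π hπ x
  obtain ⟨h1, h2⟩ := h π hπ x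
  refine Prod.ext h1 ?_
  obtain ⟨⟨q, f⟩, hq⟩ := e.surjective x.2
  have h3 : (π x).2 = e (q, f * ⟨_, h2⟩) := by simp [he, hq]
  change (e.symm (π x).2).1 = (e.symm x.2).1
  rw [h3, e.symm_apply_apply]
  change q = _
  rw [← hq, e.symm_apply_apply]

theorem LocallyFiniteGroup.finite_sup {G : Type*} [Group G] (hG : LocallyFiniteGroup G)
    {F F' : Subgroup G} (hF : (F : Set G).Finite) (hF' : (F' : Set G).Finite) :
    ((F ⊔ F' : Subgroup G) : Set G).Finite := by
  rw [← Subgroup.closure_eq F, ← Subgroup.closure_eq F', ← Subgroup.closure_union]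
  exact hG _ (hF.union hF')

theorem LocallyFiniteGroup.closure_of_movesWithin {C G : Type*} [Group G]
    (hG : LocallyFiniteGroup G) {S : Set (Equiv.Perm (C × G))}
    (hS : ∀ π ∈ S, ∃ F : Subgroup G, (F : Set G).Finite ∧ MovesWithin F π) :
    LocallyFiniteGroup (Subgroup.closure S) := by
  have hU : ∀ π ∈ Subgroup.closure S, ∃ F : Subgroup G, (F : Set G).Finite ∧ MovesWithin F π := by
    intro π hπ
    induction hπ using Subgroup.closure_induction with
    | mem π hπ => exact hS π hπ
    | one => exact ⟨⊥, by simp, fun x ↦ by simp⟩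
    | mul π ρ _ _ hπ hρ =>
      obtain ⟨F, hF, hπ⟩ := hπ
      obtain ⟨F', hF', hρ⟩ := hρ
      refine ⟨F ⊔ F', hG.finite_sup hF hF', fun x ↦ ⟨?_, ?_⟩⟩
      · rw [Equiv.Perm.mul_apply, (hπ _).1, (hρ _).1]
      · have := mul_mem ((hρ.mono le_sup_right) x).2 ((hπ.mono (le_sup_left (b := F'))) (ρ x)).2
        simpa [mul_assoc] using this
    | inv π _ hπ =>
      obtain ⟨F, hF, hπ⟩ := hπ
      refine ⟨F, hF, fun x ↦ ⟨?_, ?_⟩⟩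
      · simpa using (hπ (π⁻¹ x)).1.symm
      · simpa using inv_mem (hπ (π⁻¹ x)).2
  intro s hs
  refine Set.Finite.of_finite_image ?_ (Subgroup.closure S).subtype_injective.injOn
  rw [← Subgroup.coe_map, MonoidHom.map_closure]
  choose! F hF hFS using hU
  let E : Subgroup G := Subgroup.closure (⋃ π ∈ s, (F π : Set G))
  have hE : (E : Set G).Finite := hG _ (hs.biUnion fun π _ ↦ hF π π.2)
  refine finite_closure_of_movesWithin hE (hs.image _) ?_
  rintro _ ⟨π, hπ, rfl⟩
  refine (hFS π π.2).mono fun g hg ↦ Subgroup.subset_closure ?_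
  exact Set.mem_biUnion hπ hg

theorem exists_perm_mul_right {F R : Type*} [Group F] [Group R] [Finite F] (i j : R →* F)
    (hi : Function.Injective i) (hj : Function.Injective j) :
    ∃ σ : Equiv.Perm F, ∀ x r, σ (x * i r) = σ x * j r := by
  obtain ⟨S, e, he⟩ := exists_equiv_prod_of_injective i hi
  obtain ⟨T, d, hd⟩ := exists_equiv_prod_of_injective j hj
  have : Finite R := Finite.of_injective i hi
  have : Finite (S × R) := Finite.of_equiv F e.symm
  have : Finite (T × R) := Finite.of_equiv F d.symm
  have : Finite S := Finite.of_injective (fun s ↦ (s, (1 : R))) fun _ _ h ↦ congrArg Prod.fst h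
  have : Finite T := Finite.of_injective (fun s ↦ (s, (1 : R))) fun _ _ h ↦ congrArg Prod.fst h
  have hcard : Nat.card S = Nat.card T := by
    have h := Nat.card_congr (e.trans d.symm)
    rw [Nat.card_prod, Nat.card_prod] at h
    exact Nat.eq_of_mul_eq_mul_right Nat.card_pos h
  obtain ⟨β⟩ : Nonempty (S ≃ T) := Finite.card_eq.mp hcard
  refine ⟨(e.symm.trans (β.prodCongr (Equiv.refl R))).trans d, fun x r ↦ ?_⟩
  obtain ⟨⟨q, r'⟩, rfl⟩ := e.surjective x
  simp [← he, ← hd]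

/-- `σ` intertwines right multiplication by `p.1` and by `p.2` for all `p ∈ R`, and preserves the
left cosets of every subgroup containing both projections of `R`. -/
structure IsIntertwiner {G : Type*} [Group G] (R : Subgroup (G × G)) (σ : Equiv.Perm G) : Prop where
  map_mul : ∀ p ∈ R, ∀ x, σ (x * p.1) = σ x * p.2
  coset : ∀ F : Subgroup G, R ≤ F.prod F → ∀ x, x⁻¹ * σ x ∈ F

theorem LocallyFiniteGroup.exists_finite_prod {G : Type*} [Group G] (hG : LocallyFiniteGroup G)
    {R : Subgroup (G × G)} (hR : (R : Set (G × G)).Finite) :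
    ∃ F : Subgroup G, (F : Set G).Finite ∧ R ≤ F.prod F ∧ ∀ F', R ≤ F'.prod F' → F ≤ F' := by
  refine ⟨Subgroup.closure (Prod.fst '' (R : Set (G × G)) ∪ Prod.snd '' (R : Set (G × G))),
    hG _ ((hR.image _).union (hR.image _)), fun p hp ↦ ⟨?_, ?_⟩, fun F' hF' ↦ ?_⟩
  · exact Subgroup.subset_closure (.inl ⟨p, hp, rfl⟩)
  · exact Subgroup.subset_closure (.inr ⟨p, hp, rfl⟩)
  · rw [Subgroup.closure_le]
    rintro _ (⟨p, hp, rfl⟩ | ⟨p, hp, rfl⟩)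
    exacts [(hF' hp).1, (hF' hp).2]

theorem LocallyFiniteGroup.exists_isIntertwiner {G : Type*} [Group G] (hG : LocallyFiniteGroup G)
    {R : Subgroup (G × G)} (hR : IsFinitePartialIso R) : ∃ σ, IsIntertwiner R σ := by
  obtain ⟨F, hF, hRF, hmin⟩ := hG.exists_finite_prod hR.finite
  have : Finite F := hF
  let i : R →* F := ((MonoidHom.fst G G).comp R.subtype).codRestrict F fun p ↦ (hRF p.2).1
  let j : R →* F := ((MonoidHom.snd G G).comp R.subtype).codRestrict F fun p ↦ (hRF p.2).2
  have hi : Function.Injective i := by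
    rw [injective_iff_map_eq_one]
    intro p hp
    have h1 : p.1.1 = 1 := congrArg Subtype.val hp
    exact Subtype.ext (Prod.ext h1 (hR.fst_inj _ p.2 h1))
  have hj : Function.Injective j := by
    rw [injective_iff_map_eq_one]
    intro p hp
    have h1 : p.1.2 = 1 := congrArg Subtype.val hp
    exact Subtype.ext (Prod.ext (hR.snd_inj _ p.2 h1) h1)
  obtain ⟨σ, hσ⟩ := exists_perm_mul_right i j hi hj
  obtain ⟨T, e, he⟩ := exists_equiv_prod_of_injective F.subtype F.subtype_injective
  refine ⟨(e.symm.trans ((Equiv.refl T).prodCongr σ)).trans e, ⟨fun p hp x ↦ ?_,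
    fun F' hF' x ↦ hmin F' hF' ?_⟩⟩
  · obtain ⟨⟨q, f⟩, rfl⟩ := e.surjective x
    have h1 := he q f (i ⟨p, hp⟩)
    have h2 := he q (σ f) (j ⟨p, hp⟩)
    change _ = _ * p.1 at h1
    change _ = _ * p.2 at h2
    simp [← h1, ← h2, hσ]
  · obtain ⟨⟨q, f⟩, rfl⟩ := e.surjective x
    have h1 := he q f (f⁻¹ * σ f)
    rw [mul_inv_cancel_left] at h1
    simpa [h1] using mul_mem (inv_mem f.2) (σ f).2

/-- A choice of an intertwiner for every finite partial isomorphism. -/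
def IntertwinerChoice (G : Type*) [Group G] : Type _ :=
  {c : Subgroup (G × G) → Equiv.Perm G // ∀ R, IsFinitePartialIso R → IsIntertwiner R (c R)}

theorem LocallyFiniteGroup.nonempty_intertwinerChoice {G : Type*} [Group G]
    (hG : LocallyFiniteGroup G) : Nonempty (IntertwinerChoice G) := by
  have : ∀ R : Subgroup (G × G), ∃ σ, IsFinitePartialIso R → IsIntertwiner R σ := by
    intro R
    by_cases hR : IsFinitePartialIso R
    · obtain ⟨σ, hσ⟩ := hG.exists_isIntertwiner hR
      exact ⟨σ, fun _ ↦ hσ⟩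
    · exact ⟨1, fun h ↦ (hR h).elim⟩
  choose c hc using this
  exact ⟨⟨c, hc⟩⟩

/-- The preimage of a subgroup of `G × G` under the diagonal action of an automorphism of `G`. -/
def comapAut {G : Type*} [Group G] (α : MulAut G) (R : Subgroup (G × G)) : Subgroup (G × G) :=
  R.comap (α.toMonoidHom.prodMap α.toMonoidHom)

theorem mem_comapAut {G : Type*} [Group G] {α : MulAut G} {R : Subgroup (G × G)} {p : G × G} :
    p ∈ comapAut α R ↔ (α p.1, α p.2) ∈ R := Iff.rfl

theorem IsFinitePartialIso.comapAut {G : Type*} [Group G] {R : Subgroup (G × G)}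
    (hR : IsFinitePartialIso R) (α : MulAut G) : IsFinitePartialIso (comapAut α R) where
  finite := Set.Finite.preimage (f := Prod.map α α) (s := (R : Set (G × G)))
    (α.injective.prodMap α.injective).injOn hR.finite
  fst_inj p hp h := by simpa using hR.fst_inj _ hp (by simp [h])
  snd_inj p hp h := by simpa using hR.snd_inj _ hp (by simp [h])

theorem IsIntertwiner.conj {G : Type*} [Group G] {R : Subgroup (G × G)} {α : MulAut G}
    {σ : Equiv.Perm G} (h : IsIntertwiner (comapAut α R) σ) :
    IsIntertwiner R ((α.symm.toEquiv.trans σ).trans α.toEquiv) where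
  map_mul p hp x := by
    have := h.map_mul (α.symm p.1, α.symm p.2) (by simpa [mem_comapAut] using hp) (α.symm x)
    simpa using congrArg α this
  coset F hF x := by
    have := h.coset (F.comap α.toMonoidHom) (fun p hp ↦ hF hp) (α.symm x)
    simpa using this

instance {G : Type*} [Group G] : MulAction (MulAut G) (IntertwinerChoice G) where
  smul α c := ⟨fun R ↦ (α.symm.toEquiv.trans (c.1 (comapAut α R))).trans α.toEquiv,
    fun _ hR ↦ (c.2 _ (hR.comapAut α)).conj⟩
  one_smul _ := rfl
  mul_smul _ _ _ := rfl

theorem IntertwinerChoice.smul_apply {G : Type*} [Group G] (α : MulAut G) (c : IntertwinerChoice G)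
    (R : Subgroup (G × G)) (x : G) : (α • c).1 R x = α (c.1 (comapAut α R) (α⁻¹ x)) := rfl

/-- Right translation on the second coordinate. -/
def rightTranslation (G : Type*) [Group G] : G →* Equiv.Perm (IntertwinerChoice G × G) where
  toFun g := (Equiv.refl _).prodCongr (Equiv.mulRight g⁻¹)
  map_one' := by ext x <;> simp
  map_mul' g h := by ext x <;> simp [mul_assoc]

theorem rightTranslation_apply {G : Type*} [Group G] (g : G) (x : IntertwinerChoice G × G) :
    rightTranslation G g x = (x.1, x.2 * g⁻¹) := rfl

/-- The permutation applying the chosen intertwiner of `R` to the second coordinate. -/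
def intertwine {G : Type*} [Group G] (R : Subgroup (G × G)) :
    Equiv.Perm (IntertwinerChoice G × G) :=
  Equiv.prodCongrRight fun c ↦ c.1 R

theorem intertwine_apply {G : Type*} [Group G] (R : Subgroup (G × G))
    (x : IntertwinerChoice G × G) : intertwine R x = (x.1, x.1.1 R x.2) := rfl

theorem rightTranslation_conj {G : Type*} [Group G] (α : MulAut G) (g : G) :
    MulAction.toPermHom (MulAut G) (IntertwinerChoice G × G) α * rightTranslation G g *
      (MulAction.toPermHom (MulAut G) (IntertwinerChoice G × G) α)⁻¹ =
    rightTranslation G (α g) := by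
  rw [mul_inv_eq_iff_eq_mul]
  ext x <;> simp [rightTranslation_apply]

theorem intertwine_conj {G : Type*} [Group G] (α : MulAut G) (R : Subgroup (G × G)) :
    MulAction.toPermHom (MulAut G) (IntertwinerChoice G × G) α * intertwine R *
      (MulAction.toPermHom (MulAut G) (IntertwinerChoice G × G) α)⁻¹ =
    intertwine (comapAut α⁻¹ R) := by
  rw [mul_inv_eq_iff_eq_mul]
  ext x
  · simp [intertwine_apply]
  · have : comapAut α (comapAut α⁻¹ R) = R := by ext p; simp [mem_comapAut]
    simp [intertwine_apply, IntertwinerChoice.smul_apply, this]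

/-- The group of permutations generated by the right translations and the intertwiners. -/
def intertwinerGroup (G : Type*) [Group G] : Subgroup (Equiv.Perm (IntertwinerChoice G × G)) :=
  Subgroup.closure (Set.range (rightTranslation G) ∪ intertwine '' {R | IsFinitePartialIso R})

theorem locallyFiniteGroup_intertwinerGroup {G : Type*} [Group G] (hG : LocallyFiniteGroup G) :
    LocallyFiniteGroup (intertwinerGroup G) := by
  refine hG.closure_of_movesWithin ?_
  rintro _ (⟨g, rfl⟩ | ⟨R, hR, rfl⟩)
  · refine ⟨_, hG {g} (Set.finite_singleton g), fun x ↦ ⟨rfl, ?_⟩⟩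
    simp [rightTranslation_apply]
  · obtain ⟨F, hF, hRF, -⟩ := hG.exists_finite_prod hR.finite
    exact ⟨F, hF, fun x ↦ ⟨rfl, (x.1.2 R hR).coset F hRF x.2⟩⟩

theorem countable_isFinitePartialIso (G : Type*) [Group G] [Countable G] :
    {R : Subgroup (G × G) | IsFinitePartialIso R}.Countable := by
  have hfin : {s : Set (G × G) | s.Finite}.Countable := Set.Countable.ofPred_finite
  exact Set.MapsTo.countable_of_injOn (f := fun R : Subgroup (G × G) ↦ (R : Set (G × G)))
    (fun R hR ↦ IsFinitePartialIso.finite hR) SetLike.coe_injective.injOn hfin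

theorem countable_closure {G : Type*} [Group G] {s : Set G} (hs : s.Countable) :
    Countable (Subgroup.closure s) := by
  have := hs.to_subtype
  rw [FreeGroup.closure_eq_range]
  exact (Set.countable_range (FreeGroup.lift ((↑) : s → G))).to_subtype

instance {G : Type*} [Group G] [Countable G] : Countable (intertwinerGroup G) :=
  countable_closure ((Set.countable_range _).union ((countable_isFinitePartialIso G).image _))

theorem toPermHom_mem_normalizer {G : Type*} [Group G] (α : MulAut G) :
    MulAction.toPermHom (MulAut G) (IntertwinerChoice G × G) α ∈
      Subgroup.normalizer (intertwinerGroup G : Set (Equiv.Perm (IntertwinerChoice G × G))) := by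
  have key : ∀ (β : MulAut G), ∀ π ∈ intertwinerGroup G,
      MulAction.toPermHom (MulAut G) (IntertwinerChoice G × G) β * π *
        (MulAction.toPermHom (MulAut G) (IntertwinerChoice G × G) β)⁻¹ ∈ intertwinerGroup G := by
    intro β
    change intertwinerGroup G ≤ (intertwinerGroup G).comap (MulAut.conj _).toMonoidHom
    refine (Subgroup.closure_le _).2 ?_
    rintro _ (⟨g, rfl⟩ | ⟨R, hR, rfl⟩)
    · refine Subgroup.subset_closure (.inl ⟨β g, ?_⟩)
      exact (rightTranslation_conj β g).symm
    · refine Subgroup.subset_closure (.inr ⟨_, IsFinitePartialIso.comapAut hR β⁻¹, ?_⟩)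
      exact (intertwine_conj β R).symm
  rw [Subgroup.mem_normalizer_iff]
  refine fun π ↦ ⟨key α π, fun h ↦ ?_⟩
  have := key α⁻¹ _ h
  rw [map_inv] at this
  simpa only [mul_assoc, inv_mul_cancel_left, inv_inv, inv_mul_cancel, mul_one] using this

/-- Every countable locally finite group embeds in another one, compatibly with automorphisms, such
that its finite partial isomorphisms are induced by inner automorphisms of the larger group. -/
theorem LocallyFiniteGroup.exists_equivariant_extension {G : Type u} [Group G] [Countable G]
    (hG : LocallyFiniteGroup G) :
    ∃ (K : Type u) (_ : Group K) (ι : G →* K) (κ : MulAut G →* MulAut K), Countable K ∧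
      LocallyFiniteGroup K ∧ Function.Injective ι ∧ (∀ α g, κ α (ι g) = ι (α g)) ∧
      ∀ R : Subgroup (G × G), IsFinitePartialIso R →
        ∃ k, ∀ p ∈ R, k * ι p.1 * k⁻¹ = ι p.2 := by
  refine ⟨intertwinerGroup G, inferInstance,
    (rightTranslation G).codRestrict _ fun g ↦ Subgroup.subset_closure (.inl ⟨g, rfl⟩),
    (intertwinerGroup G).normalizerMonoidHom.comp
      ((MulAction.toPermHom (MulAut G) (IntertwinerChoice G × G)).codRestrict _
        toPermHom_mem_normalizer), inferInstance, locallyFiniteGroup_intertwinerGroup hG, ?_, ?_, ?_⟩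
  · obtain ⟨c⟩ := hG.nonempty_intertwinerChoice
    intro g h hgh
    have : 1 * g⁻¹ = 1 * h⁻¹ := congrArg (fun π ↦ (π.1 (c, 1)).2) hgh
    simpa using this
  · exact fun α g ↦ Subtype.ext (rightTranslation_conj α g)
  · intro R hR
    refine ⟨⟨intertwine R, Subgroup.subset_closure (.inr ⟨R, hR, rfl⟩)⟩, fun p hp ↦
      Subtype.ext ?_⟩
    change intertwine R * rightTranslation G p.1 * (intertwine R)⁻¹ = rightTranslation G p.2
    rw [mul_inv_eq_iff_eq_mul]
    ext x
    · rfl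
    · exact (x.1.2 R hR).map_mul _ (inv_mem hp) x.2

section SequentialLimit

variable {F : ℕ → Type*} [∀ n, Group (F n)] (f : ∀ n, F n →* F (n + 1))

/-- The composite `F m →* F n` of the successive maps of a sequence of groups. -/
def transitionHom (m n : ℕ) (h : m ≤ n) : F m →* F n :=
  Nat.leRecOn h (fun {k} g ↦ (f k).comp g) (MonoidHom.id _)

theorem transitionHom_self (m : ℕ) : transitionHom f m m le_rfl = MonoidHom.id _ :=
  Nat.leRecOn_self _

theorem transitionHom_succ (m n : ℕ) (h : m ≤ n) :
    transitionHom f m (n + 1) (h.trans n.le_succ) = (f n).comp (transitionHom f m n h) :=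
  Nat.leRecOn_succ h _

theorem transitionHom_comp (i j k : ℕ) (hij : i ≤ j) (hjk : j ≤ k) :
    (transitionHom f j k hjk).comp (transitionHom f i j hij) =
      transitionHom f i k (hij.trans hjk) := by
  induction k, hjk using Nat.le_induction with
  | base => rw [transitionHom_self, MonoidHom.id_comp]
  | succ k hjk ih =>
    rw [transitionHom_succ f j k hjk, transitionHom_succ f i k (hij.trans hjk), ← ih,
      MonoidHom.comp_assoc]

instance : DirectedSystem F (transitionHom f · · ·) where
  map_self i x := by rw [transitionHom_self]; rfl
  map_map _ _ _ hij hjk x := by rw [← transitionHom_comp f _ _ _ hij hjk]; rfl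

theorem transitionHom_injective (hf : ∀ n, Function.Injective (f n)) (m n : ℕ) (h : m ≤ n) :
    Function.Injective (transitionHom f m n h) := by
  induction n, h using Nat.le_induction with
  | base => rw [transitionHom_self]; exact Function.injective_id
  | succ k hk ih => rw [transitionHom_succ f m k hk]; exact (hf k).comp ih

theorem transitionHom_equivariant {Γ : Type*} [Group Γ] (act : ∀ n, Γ →* MulAut (F n))
    (hact : ∀ n γ x, f n (act n γ x) = act (n + 1) γ (f n x)) (m n : ℕ) (h : m ≤ n) (γ : Γ)
    (x : F m) : transitionHom f m n h (act m γ x) = act n γ (transitionHom f m n h x) := by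
  induction n, h using Nat.le_induction with
  | base => rw [transitionHom_self]; rfl
  | succ k hk ih => rw [transitionHom_succ f m k hk]; simp [ih, hact]

/-- The direct limit of a sequence of injective equivariant homomorphisms of groups. -/
theorem exists_sequential_limit {F : ℕ → Type u} [∀ n, Group (F n)] (f : ∀ n, F n →* F (n + 1))
    (hf : ∀ n, Function.Injective (f n)) {Γ : Type*} [Group Γ] (act : ∀ n, Γ →* MulAut (F n))
    (hact : ∀ n γ x, f n (act n γ x) = act (n + 1) γ (f n x)) :
    ∃ (M : Type u) (_ : Group M) (j : ∀ n, F n →* M) (κ : Γ →* MulAut M),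
      (∀ n, Function.Injective (j n)) ∧ (∀ n x, j (n + 1) (f n x) = j n x) ∧
      (∀ n γ x, κ γ (j n x) = j n (act n γ x)) ∧
      ∀ x, ∃ n y, j n y = x := by
  let M := DirectLimit F (transitionHom f)
  let j : ∀ n, F n →* M := fun n ↦ MonoidHom.mk' (fun x ↦ ⟦⟨n, x⟩⟧)
    fun x y ↦ (DirectLimit.mul_def n x y).symm
  have hj : ∀ m n h x, j n (transitionHom f m n h x) = j m x := fun m n h x ↦
    (DirectLimit.eq_of_le ⟨m, x⟩ n h).symm
  have hjs : ∀ x, ∃ n y, j n y = x := fun x ↦ by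
    obtain ⟨n, y, rfl⟩ := DirectLimit.exists_eq_mk _ x
    exact ⟨n, y, rfl⟩
  let φ : Γ → M → M := fun γ ↦ DirectLimit.map _ _ (fun n ↦ act n γ)
    fun m n h x ↦ transitionHom_equivariant f act hact m n h γ x
  have hφ : ∀ γ n x, φ γ (j n x) = j n (act n γ x) := fun _ _ _ ↦ rfl
  have hφmul : ∀ γ x y, φ γ (x * y) = φ γ x * φ γ y := by
    intro γ x y
    obtain ⟨n, x', y', rfl, rfl⟩ := DirectLimit.exists_eq_mk₂ _ x y
    change φ γ (j n x' * j n y') = φ γ (j n x') * φ γ (j n y')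
    rw [← map_mul, hφ, hφ, hφ, map_mul, map_mul]
  have hφone : ∀ x, φ 1 x = x := by
    intro x
    obtain ⟨n, y, rfl⟩ := hjs x
    rw [hφ, map_one, MulAut.one_apply]
  have hφcomp : ∀ γ δ x, φ (γ * δ) x = φ γ (φ δ x) := by
    intro γ δ x
    obtain ⟨n, y, rfl⟩ := hjs x
    rw [hφ, hφ, hφ, map_mul, MulAut.mul_apply]
  refine ⟨M, inferInstance, j,
    { toFun := fun γ ↦
        { toFun := φ γ
          invFun := φ γ⁻¹
          left_inv := fun x ↦ by rw [← hφcomp, inv_mul_cancel, hφone]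
          right_inv := fun x ↦ by rw [← hφcomp, mul_inv_cancel, hφone]
          map_mul' := hφmul γ }
      map_one' := by ext x; exact hφone x
      map_mul' := fun γ δ ↦ by ext x; exact hφcomp γ δ x }, ?_, ?_, fun n γ x ↦ hφ γ n x, hjs⟩
  · exact fun n ↦ DirectLimit.mk_injective _ (transitionHom_injective f hf) n
  · intro n x
    have := hj n (n + 1) n.le_succ x
    rwa [transitionHom_succ f n n le_rfl, transitionHom_self] at this

end SequentialLimit

/-- A countable locally finite group with an action of `Γ`. -/
structure CountableLocallyFiniteAction (Γ : Type v) [Group Γ] where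
  carrier : Type u
  [group : Group carrier]
  countable : Countable carrier
  locallyFinite : LocallyFiniteGroup carrier
  act : Γ →* MulAut carrier

attribute [instance] CountableLocallyFiniteAction.group

theorem CountableLocallyFiniteAction.exists_extension {Γ : Type v} [Group Γ]
    (S : CountableLocallyFiniteAction.{u, v} Γ) :
    ∃ (T : CountableLocallyFiniteAction.{u, v} Γ) (ι : S.carrier →* T.carrier),
      Function.Injective ι ∧ (∀ γ x, ι (S.act γ x) = T.act γ (ι x)) ∧
      ∀ R : Subgroup (S.carrier × S.carrier), IsFinitePartialIso R →
        ∃ k, ∀ p ∈ R, k * ι p.1 * k⁻¹ = ι p.2 := by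
  have := S.countable
  obtain ⟨K, _, ι, κ, hc, hlf, hι, hκ, h⟩ := S.locallyFinite.exists_equivariant_extension
  exact ⟨⟨K, hc, hlf, κ.comp S.act⟩, ι, hι, fun γ x ↦ (hκ _ _).symm, h⟩

/-- Every finite partial isomorphism of `M` is induced by an inner automorphism. -/
def IsInnerHomogeneous (M : Type*) [Group M] : Prop :=
  ∀ R : Subgroup (M × M), IsFinitePartialIso R → ∃ k, ∀ p ∈ R, k * p.1 * k⁻¹ = p.2

theorem IsFinitePartialIso.comap {G G' M M' : Type*} [Group G] [Group G'] [Group M] [Group M']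
    {R : Subgroup (G' × M')} (hR : IsFinitePartialIso R) (f : G →* G') (g : M →* M')
    (hf : Function.Injective f) (hg : Function.Injective g) :
    IsFinitePartialIso (R.comap (f.prodMap g)) where
  finite := Set.Finite.preimage (f := Prod.map f g) (s := (R : Set (G' × M')))
    (hf.prodMap hg).injOn hR.finite
  fst_inj p hp h := hg (by simpa using hR.fst_inj _ hp (by simp [h]))
  snd_inj p hp h := hf (by simpa using hR.snd_inj _ hp (by simp [h]))

/-- A finite set in the union of an increasing sequence of subgroups lies in one of them. -/
theorem exists_subset_of_monotone {M : Type*} {A : ℕ → Set M} (hA : Monotone A)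
    (hcov : ∀ x, ∃ n, x ∈ A n) {s : Set M} (hs : s.Finite) : ∃ n, s ⊆ A n := by
  choose N hN using hcov
  obtain ⟨b, hb⟩ := (hs.image N).bddAbove
  exact ⟨b, fun x hx ↦ hA (hb ⟨x, hx, rfl⟩) (hN x)⟩

theorem CountableLocallyFiniteAction.exists_isInnerHomogeneous {Γ : Type v} [Group Γ]
    (S : CountableLocallyFiniteAction.{u, v} Γ) :
    ∃ (T : CountableLocallyFiniteAction.{u, v} Γ) (ι : S.carrier →* T.carrier),
      Function.Injective ι ∧ (∀ γ x, ι (S.act γ x) = T.act γ (ι x)) ∧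
      IsInnerHomogeneous T.carrier := by
  choose next ι hι heq hin using exists_extension.{u, v} (Γ := Γ)
  let F : ℕ → CountableLocallyFiniteAction.{u, v} Γ :=
    Nat.rec (motive := fun _ ↦ CountableLocallyFiniteAction.{u, v} Γ) S fun _ T ↦ next T
  let f : ∀ n, (F n).carrier →* (F (n + 1)).carrier := fun n ↦ ι (F n)
  obtain ⟨M, _, j, κ, hj, hjs, hκ, hsurj⟩ := exists_sequential_limit f (fun n ↦ hι (F n))
    (fun n ↦ (F n).act) (fun n ↦ heq (F n))
  have hmono : Monotone fun n ↦ Set.range (j n) := by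
    refine monotone_nat_of_le_succ fun n ↦ ?_
    rintro _ ⟨x, rfl⟩
    exact ⟨_, hjs n x⟩
  have hcount : Countable M := by
    have : ∀ n, Countable (F n).carrier := fun n ↦ (F n).countable
    refine Function.Surjective.countable (f := fun p : Σ n, (F n).carrier ↦ j p.1 p.2) ?_
    intro x
    obtain ⟨n, y, rfl⟩ := hsurj x
    exact ⟨⟨n, y⟩, rfl⟩
  have hlf : LocallyFiniteGroup M := by
    intro s hs
    obtain ⟨n, hn⟩ := exists_subset_of_monotone hmono hsurj hs
    rw [← Set.image_preimage_eq_of_subset hn, ← MonoidHom.map_closure, Subgroup.coe_map]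
    exact ((F n).locallyFinite _ (hs.preimage (hj n).injOn)).image _
  refine ⟨⟨M, hcount, hlf, κ⟩, j 0, hj 0, fun γ x ↦ (hκ 0 γ x).symm, fun R hR ↦ ?_⟩
  obtain ⟨n, hn⟩ := exists_subset_of_monotone hmono hsurj
    ((hR.finite.image Prod.fst).union (hR.finite.image Prod.snd))
  obtain ⟨k, hk⟩ := hin (F n) _ (hR.comap (j n) (j n) (hj n) (hj n))
  refine ⟨j (n + 1) k, fun p hp ↦ ?_⟩
  obtain ⟨x, hx⟩ := hn (.inl ⟨p, hp, rfl⟩)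
  obtain ⟨y, hy⟩ := hn (.inr ⟨p, hp, rfl⟩)
  have hxy : ((x, y) : _ × _) ∈ R.comap ((j n).prodMap (j n)) := by
    change (j n x, j n y) ∈ R
    rwa [hx, hy]
  have := congrArg (j (n + 1)) (hk _ hxy)
  rw [map_mul, map_mul, map_inv] at this
  change _ * j (n + 1) (ι (F n) x) * _ = j (n + 1) (ι (F n) y) at this
  rwa [hjs, hjs, hx, hy] at this

theorem isFinitePartialIso_range_prod {A G M : Type*} [Group A] [Group G] [Group M] [Finite A]
    (f : A →* G) (g : A →* M) (hf : Function.Injective f) (hg : Function.Injective g) :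
    IsFinitePartialIso (f.prod g).range where
  finite := Set.finite_range (f.prod g)
  fst_inj := by
    rintro _ ⟨a, rfl⟩ h
    have : a = 1 := hf (h.trans (map_one f).symm)
    simp [this]
  snd_inj := by
    rintro _ ⟨a, rfl⟩ h
    have : a = 1 := hg (h.trans (map_one g).symm)
    simp [this]

theorem IsFinitePartialIso.fst_injective {G M : Type*} [Group G] [Group M] {R : Subgroup (G × M)}
    (hR : IsFinitePartialIso R) : Function.Injective ((MonoidHom.fst G M).comp R.subtype) := by
  rw [injective_iff_map_eq_one]
  exact fun p hp ↦ Subtype.ext (Prod.ext hp (hR.fst_inj _ p.2 hp))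

theorem IsFinitePartialIso.snd_injective {G M : Type*} [Group G] [Group M] {R : Subgroup (G × M)}
    (hR : IsFinitePartialIso R) : Function.Injective ((MonoidHom.snd G M).comp R.subtype) := by
  rw [injective_iff_map_eq_one]
  exact fun p hp ↦ Subtype.ext (Prod.ext (hR.snd_inj _ p.2 hp) hp)

theorem IsFinitePartialIso.swap {G M : Type*} [Group G] [Group M] {R : Subgroup (G × M)}
    (hR : IsFinitePartialIso R) :
    IsFinitePartialIso (R.comap (MulEquiv.prodComm : M × G ≃* G × M).toMonoidHom) where
  finite := Set.Finite.preimage (f := Prod.swap) (s := (R : Set (G × M)))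
    Prod.swap_injective.injOn hR.finite
  fst_inj _ hp h := hR.snd_inj _ hp h
  snd_inj _ hp h := hR.fst_inj _ hp h

theorem IsFinitePartialIso.exists_extension_fst {G M : Type u} [Group G] [Group M]
    (hG : LocallyFiniteGroup G) (hM : IsInnerHomogeneous M)
    (hemb : ∀ (A : Type u) [Group A] [Finite A], ∃ e : A →* M, Function.Injective e)
    {R : Subgroup (G × M)} (hR : IsFinitePartialIso R) (g : G) :
    ∃ R' : Subgroup (G × M), IsFinitePartialIso R' ∧ R ≤ R' ∧ ∃ m, (g, m) ∈ R' := by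
  let A := Subgroup.closure (Prod.fst '' (R : Set (G × M)) ∪ {g})
  have : Finite A := hG _ ((hR.finite.image _).union (Set.finite_singleton g))
  have : Finite R := hR.finite
  have hRA : ∀ p : R, p.1.1 ∈ A := fun p ↦ Subgroup.subset_closure (.inl ⟨p, p.2, rfl⟩)
  have hgA : g ∈ A := Subgroup.subset_closure (.inr rfl)
  obtain ⟨e, he⟩ := hemb A
  let i : R →* A := ((MonoidHom.fst G M).comp R.subtype).codRestrict A hRA
  have hi : Function.Injective i := fun p q h ↦ hR.fst_injective (congrArg Subtype.val h)
  obtain ⟨k, hk⟩ := hM _ (isFinitePartialIso_range_prod (e.comp i)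
    ((MonoidHom.snd G M).comp R.subtype) (he.comp hi) hR.snd_injective)
  refine ⟨_, isFinitePartialIso_range_prod A.subtype ((MulAut.conj k).toMonoidHom.comp e)
    A.subtype_injective ((MulAut.conj k).injective.comp he), fun p hp ↦ ?_, ?_⟩
  · exact ⟨i ⟨p, hp⟩, Prod.ext rfl (hk _ ⟨⟨p, hp⟩, rfl⟩)⟩
  · exact ⟨_, ⟨g, hgA⟩, rfl⟩

theorem IsFinitePartialIso.exists_extension_snd {G M : Type u} [Group G] [Group M]
    (hM : LocallyFiniteGroup M) (hG : IsInnerHomogeneous G)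
    (hemb : ∀ (A : Type u) [Group A] [Finite A], ∃ e : A →* G, Function.Injective e)
    {R : Subgroup (G × M)} (hR : IsFinitePartialIso R) (m : M) :
    ∃ R' : Subgroup (G × M), IsFinitePartialIso R' ∧ R ≤ R' ∧ ∃ g, (g, m) ∈ R' := by
  obtain ⟨R', hR', hle, g, hg⟩ := hR.swap.exists_extension_fst hM hG hemb m
  exact ⟨_, hR'.swap, fun p hp ↦ hle (x := p.swap) hp, g, hg⟩

theorem IsFinitePartialIso.eq_iff {G M : Type*} [Group G] [Group M] {R : Subgroup (G × M)}
    (hR : IsFinitePartialIso R) {p q : G × M} (hp : p ∈ R) (hq : q ∈ R) : p.1 = q.1 ↔ p.2 = q.2 :=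
  ⟨fun h ↦ congrArg (fun r : R ↦ r.1.2) (hR.fst_injective (a₁ := ⟨p, hp⟩) (a₂ := ⟨q, hq⟩) h),
    fun h ↦ congrArg (fun r : R ↦ r.1.1) (hR.snd_injective (a₁ := ⟨p, hp⟩) (a₂ := ⟨q, hq⟩) h)⟩

/-- **Uniqueness of Hall's universal group.** -/
theorem nonempty_mulEquiv_of_isInnerHomogeneous {G M : Type u} [Group G] [Group M] [Countable G]
    [Countable M] (hG : LocallyFiniteGroup G) (hM : LocallyFiniteGroup M)
    (hG' : IsInnerHomogeneous G) (hM' : IsInnerHomogeneous M)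
    (hembG : ∀ (A : Type u) [Group A] [Finite A], ∃ e : A →* G, Function.Injective e)
    (hembM : ∀ (A : Type u) [Group A] [Finite A], ∃ e : A →* M, Function.Injective e) :
    Nonempty (G ≃* M) := by
  let P := {R : Subgroup (G × M) // IsFinitePartialIso R}
  let D : G ⊕ M → Order.Cofinal P := Sum.elim
    (fun g ↦ ⟨{R | ∃ m, (g, m) ∈ R.1}, fun R ↦ by
      obtain ⟨R', hR', hle, h⟩ := R.2.exists_extension_fst hG hM' hembM g
      exact ⟨⟨R', hR'⟩, h, hle⟩⟩)
    (fun m ↦ ⟨{R | ∃ g, (g, m) ∈ R.1}, fun R ↦ by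
      obtain ⟨R', hR', hle, h⟩ := R.2.exists_extension_snd hM hG' hembG m
      exact ⟨⟨R', hR'⟩, h, hle⟩⟩)
  let R₀ : P := ⟨⊥, by simp, fun p hp _ ↦ by rw [Subgroup.mem_bot.1 hp]; rfl,
    fun p hp _ ↦ by rw [Subgroup.mem_bot.1 hp]; rfl⟩
  let : Encodable (G ⊕ M) := Encodable.ofCountable _
  let I := Order.idealOfCofinals R₀ D
  have hfst : ∀ g, ∃ m, ∃ R ∈ I, (g, m) ∈ R.1 := fun g ↦ by
    obtain ⟨R, ⟨m, hm⟩, hR⟩ := Order.cofinal_meets_idealOfCofinals R₀ D (.inl g)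
    exact ⟨m, R, hR, hm⟩
  have hsnd : ∀ m, ∃ g, ∃ R ∈ I, (g, m) ∈ R.1 := fun m ↦ by
    obtain ⟨R, ⟨g, hg⟩, hR⟩ := Order.cofinal_meets_idealOfCofinals R₀ D (.inr m)
    exact ⟨g, R, hR, hg⟩
  have hdir : ∀ R ∈ I, ∀ R' ∈ I, ∃ R'' ∈ I, R.1 ≤ R''.1 ∧ R'.1 ≤ R''.1 :=
    fun R hR R' hR' ↦ I.directed R hR R' hR'
  choose φ S hS hφ using hfst
  have key : ∀ g R m, R ∈ I → (g, m) ∈ R.1 → φ g = m := by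
    intro g R m hR hm
    obtain ⟨R', -, h1, h2⟩ := hdir _ (hS g) _ hR
    exact (R'.2.eq_iff (h1 (hφ g)) (h2 hm)).1 rfl
  have hmul : ∀ x y, φ (x * y) = φ x * φ y := by
    intro x y
    obtain ⟨R, hR, h1, h2⟩ := hdir _ (hS x) _ (hS y)
    exact key _ R _ hR (mul_mem (h1 (hφ x)) (h2 (hφ y)))
  refine ⟨MulEquiv.ofBijective (MonoidHom.mk' φ hmul) ⟨fun x y hxy ↦ ?_, fun m ↦ ?_⟩⟩
  · obtain ⟨R, hR, h1, h2⟩ := hdir _ (hS x) _ (hS y)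
    exact (R.2.eq_iff (h1 (hφ x)) (h2 (hφ y))).2 hxy
  · obtain ⟨g, R, hR, h⟩ := hsnd m
    exact ⟨g, key g R m hR h⟩

theorem isInnerHomogeneous_of_forall_mulEquiv {H : Type*} [Group H]
    (hHom : ∀ K L : Subgroup H, (K : Set H).Finite → (L : Set H).Finite →
      ∀ φ : ↥K ≃* ↥L, ∃ h : H, ∀ k : K, (φ k : H) = h * (k : H) * h⁻¹) :
    IsInnerHomogeneous H := by
  intro R hR
  have : Finite R := hR.finite
  let ψ := MonoidHom.ofInjective hR.fst_injective
  obtain ⟨h, hh⟩ := hHom _ _ (Set.finite_range ((MonoidHom.fst H H).comp R.subtype))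
    (Set.finite_range ((MonoidHom.snd H H).comp R.subtype))
    (ψ.symm.trans (MonoidHom.ofInjective hR.snd_injective))
  refine ⟨h, fun p hp ↦ ?_⟩
  have := hh (ψ ⟨p, hp⟩)
  rw [MulEquiv.trans_apply, MulEquiv.symm_apply_apply] at this
  exact this.symm

/-- The action of the automorphisms of `G` on the first factor of `G × H`. -/
def mulAutProdLeft (G H : Type*) [Group G] [Group H] : MulAut G →* MulAut (G × H) where
  toFun α := α.prodCongr (MulEquiv.refl H)
  map_one' := rfl
  map_mul' _ _ := rfl


/-- **Universality of `Aut(H)` for automorphism groups of countable locally finite groups.**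
If `H` is Hall's universal group, then for every countable locally finite group `G` there is
an embedding `e : G → H` and an embedding `Φ : Aut(G) → Aut(H)` such that `Φ f` extends the
action of `f` on the copy `e(G)` of `G`, i.e. `Φ f (e x) = e (f x)`. -/
theorem aut_hall_universal_for_automorphisms
    {H : Type} [Group H] [Countable H]
    (hLF : ∀ s : Finset H, ((Subgroup.closure (s : Set H) : Subgroup H) : Set H).Finite)
    (hEmb : ∀ (G : Type) [Group G] [Finite G], ∃ e : G →* H, Function.Injective e)
    (hHom : ∀ K L : Subgroup H, (K : Set H).Finite → (L : Set H).Finite →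
      ∀ φ : ↥K ≃* ↥L, ∃ h : H, ∀ k : K, (φ k : H) = h * (k : H) * h⁻¹)
    (G : Type) [Group G] [Countable G]
    (hGlf : ∀ s : Finset G, ((Subgroup.closure (s : Set G) : Subgroup G) : Set G).Finite) :
    ∃ e : G →* H, Function.Injective e ∧
      ∃ Φ : MulAut G →* MulAut H, Function.Injective Φ ∧
        ∀ (f : MulAut G) (x : G), Φ f (e x) = e (f x) := by
  have hG' : LocallyFiniteGroup G := fun s hs ↦ by simpa using hGlf hs.toFinset
  have hH' : LocallyFiniteGroup H := fun s hs ↦ by simpa using hLF hs.toFinset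
  let S : CountableLocallyFiniteAction.{0, 0} (MulAut G) :=
    ⟨G × H, inferInstance, hG'.prod hH', mulAutProdLeft G H⟩
  obtain ⟨T, ι, hι, heq, hT⟩ := S.exists_isInnerHomogeneous
  have := T.countable
  obtain ⟨θ⟩ := nonempty_mulEquiv_of_isInnerHomogeneous T.locallyFinite hH' hT
    (isInnerHomogeneous_of_forall_mulEquiv hHom)
    (fun A _ _ ↦ by
      obtain ⟨e, he⟩ := hEmb A
      exact ⟨ι.comp ((MonoidHom.inr G H).comp e),
        hι.comp ((Prod.mk_right_injective (1 : G)).comp he)⟩)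
    (fun A _ _ ↦ hEmb A)
  let e : G →* H := θ.toMonoidHom.comp (ι.comp (MonoidHom.inl G H))
  have he : Function.Injective e := θ.injective.comp (hι.comp (Prod.mk_left_injective (1 : H)))
  let Φ : MulAut G →* MulAut H := (MulAut.congr θ).toMonoidHom.comp T.act
  have hΦ : ∀ (f : MulAut G) (x : G), Φ f (e x) = e (f x) := by
    intro f x
    change θ (T.act f (θ.symm (θ (ι (x, 1))))) = θ (ι (f x, 1))
    rw [θ.symm_apply_apply, ← heq]
    rfl
  refine ⟨e, he, Φ, fun f g hfg ↦ ?_, hΦ⟩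
  ext x
  exact he (by rw [← hΦ, ← hΦ, hfg])
end

section
/- Let H be Hall's universal group. Then there exists an infinite subset S ⊆ H such that every permutation of S can be lifted to an automorphism of H, i.e. for every bijection σ : S → S there exists F ∈ Aut(H) with F(s) = σ(s) for all s ∈ S. -/
/-- Hall's universal group, without the countability assumption. -/
structure IsHallGroup (H : Type) [Group H] : Prop where
  finite_closure : ∀ s : Finset H, ((Subgroup.closure (s : Set H) : Subgroup H) : Set H).Finite
  exists_embedding : ∀ (G : Type) [Group G] [Finite G], ∃ e : G →* H, Function.Injective e
  exists_conj : ∀ K L : Subgroup H, (K : Set H).Finite → (L : Set H).Finite →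
    ∀ φ : ↥K ≃* ↥L, ∃ h : H, ∀ k : K, (φ k : H) = h * (k : H) * h⁻¹

/-- Every value of `e` commutes with every element of `A`. -/
def Centralizes {H T : Type} [Group H] [Group T] (e : T →* H) (A : Set H) : Prop :=
  ∀ x, ∀ a ∈ A, Commute (e x) a

section Centralizes

variable {H T : Type} [Group H] [Group T] {e : T →* H} {A B : Set H}

theorem Centralizes.mono (h : Centralizes e B) (hAB : A ⊆ B) : Centralizes e A :=
  fun x a ha => h x a (hAB ha)

theorem Centralizes.union (hA : Centralizes e A) (hB : Centralizes e B) :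
    Centralizes e (A ∪ B) := by
  rintro x a (ha | ha)
  exacts [hA x a ha, hB x a ha]

theorem commute_of_mem_closure {y : H} (h : ∀ a ∈ A, Commute y a) :
    ∀ a ∈ Subgroup.closure A, Commute y a := by
  have : Subgroup.closure A ≤ Subgroup.centralizer {y} := by
    rw [Subgroup.closure_le]
    intro a ha
    rw [SetLike.mem_coe, Subgroup.mem_centralizer_singleton_iff]
    exact ((h a ha).eq).symm
  intro a ha
  exact ((Subgroup.mem_centralizer_singleton_iff.1 (this ha))).symm

theorem Centralizes.closure (h : Centralizes e A) : Centralizes e (Subgroup.closure A : Set H) :=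
  fun x => commute_of_mem_closure (h x)

theorem Centralizes.conj (h : Centralizes e A) {g : H} (hg : ∀ x, Commute (e x) g) :
    Centralizes e (MulAut.conj g '' A) := by
  rintro x _ ⟨a, ha, rfl⟩
  rw [MulAut.conj_apply]
  exact ((hg x).mul_right (h x a ha)).mul_right (hg x).inv_right

theorem Centralizes.eq_one (hT : Subgroup.center T = ⊥) (he : Function.Injective e)
    {t : T} (h : ∀ x, Commute (e x) (e t)) : t = 1 := by
  have : t ∈ Subgroup.center T := by
    rw [Subgroup.mem_center_iff]
    intro x
    apply he
    simpa using (h x).eq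
  simpa [hT] using this

theorem noncommCoprod_injective {P : Type} [Group P] (hT : Subgroup.center T = ⊥)
    {f : P →* H} (hf : Function.Injective f) (he : Function.Injective e)
    (comm : ∀ p t, Commute (f p) (e t)) : Function.Injective (f.noncommCoprod e comm) := by
  rw [injective_iff_map_eq_one]
  rintro ⟨p, t⟩ h
  rw [MonoidHom.noncommCoprod_apply] at h
  have h1 : e t = f p⁻¹ := by
    rw [map_inv]
    exact eq_inv_of_mul_eq_one_right h
  have h2 : t = 1 := Centralizes.eq_one hT he fun x => h1 ▸ (comm _ x).symm
  subst h2
  have : p = 1 := hf (by simpa using h)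
  simp [this]

end Centralizes

namespace IsHallGroup

variable {H T : Type} [Group H] [Group T] {e : T →* H} {A B : Set H}

theorem finite_closure_set (hH : IsHallGroup H) (hA : A.Finite) :
    (Subgroup.closure A : Set H).Finite := by
  simpa using hH.finite_closure hA.toFinset

theorem exists_conj_hom (hH : IsHallGroup H) {P : Type} [Group P] [Finite P] {f₁ f₂ : P →* H}
    (h₁ : Function.Injective f₁) (h₂ : Function.Injective f₂) :
    ∃ g : H, ∀ p, MulAut.conj g (f₁ p) = f₂ p := by
  obtain ⟨g, hg⟩ := hH.exists_conj f₁.range f₂.range (Set.finite_range f₁) (Set.finite_range f₂)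
    ((MonoidHom.ofInjective h₁).symm.trans (MonoidHom.ofInjective h₂))
  refine ⟨g, fun p => ?_⟩
  have := hg (MonoidHom.ofInjective h₁ p)
  simp only [MulEquiv.trans_apply, MulEquiv.symm_apply_apply] at this
  exact this.symm

/-- Conjugations can be modified to have a prescribed effect on a centreless group
centralizing the given set. -/
theorem exists_conj_extend [Finite T] (hH : IsHallGroup H) (hT : Subgroup.center T = ⊥)
    (hA : A.Finite) {e' : T →* H} (he : Function.Injective e) (he' : Function.Injective e') {g : H}
    (hc : Centralizes e A) (hc' : Centralizes e' (MulAut.conj g '' A)) :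
    ∃ g' : H, (∀ a ∈ A, MulAut.conj g' a = MulAut.conj g a) ∧
      ∀ x, MulAut.conj g' (e x) = e' x := by
  have : Finite (Subgroup.closure A) := hH.finite_closure_set hA
  have hc₁ := hc.closure
  have hc₂ : Centralizes e' (MulAut.conj g '' (Subgroup.closure A)) := by
    have := hc'.closure
    rwa [← MulEquiv.coe_toMonoidHom, ← MonoidHom.map_closure, Subgroup.coe_map] at this
  have h₁ := noncommCoprod_injective hT (Subgroup.closure A).subtype_injective he
    fun p t => (hc₁ t p p.2).symm
  have h₂ := noncommCoprod_injective hT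
    (f := (MulAut.conj g).toMonoidHom.comp (Subgroup.closure A).subtype)
    ((MulAut.conj g).injective.comp (Subgroup.closure A).subtype_injective) he'
    fun p t => (hc₂ t _ ⟨p, p.2, rfl⟩).symm
  obtain ⟨g', hg'⟩ := hH.exists_conj_hom h₁ h₂
  refine ⟨g', fun a ha => ?_, fun x => ?_⟩
  · have h : MulAut.conj g' (a * e 1) = MulAut.conj g a * e' 1 :=
      hg' (⟨a, Subgroup.subset_closure ha⟩, 1)
    simpa using h
  · have h : MulAut.conj g' (1 * e x) = MulAut.conj g 1 * e' x := hg' (1, x)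
    simpa using h

theorem exists_centralizing (hH : IsHallGroup H) (T : Type) [Group T] [Finite T] (hA : A.Finite) :
    ∃ e : T →* H, Function.Injective e ∧ Centralizes e A := by
  have : Finite (Subgroup.closure A) := hH.finite_closure_set hA
  obtain ⟨j, hj⟩ := hH.exists_embedding (Subgroup.closure A × T)
  obtain ⟨g, hg⟩ := hH.exists_conj_hom (f₁ := j.comp (MonoidHom.inl _ _))
    (hj.comp (Prod.mk_left_injective 1)) (Subgroup.closure A).subtype_injective
  refine ⟨(MulAut.conj g).toMonoidHom.comp (j.comp (MonoidHom.inr _ _)),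
    (MulAut.conj g).injective.comp (hj.comp (Prod.mk_right_injective 1)), fun x a ha => ?_⟩
  have h1 := hg ⟨a, Subgroup.subset_closure ha⟩
  rw [Subgroup.subtype_apply] at h1
  simp only at h1
  rw [← h1]
  refine Commute.map (Commute.map ?_ j) (MulAut.conj g)
  exact (MonoidHom.commute_inl_inr _ _).symm

/-- Amalgamation: a finite set can be moved, fixing a subset centralized by `e`, into the
centralizer of `e`. -/
theorem exists_conj_centralizes [Finite T] (hH : IsHallGroup H) (hT : Subgroup.center T = ⊥)
    (hB : B.Finite) (hAB : A ⊆ B) (he : Function.Injective e) (hc : Centralizes e A) :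
    ∃ h : H, (∀ a ∈ A, MulAut.conj h a = a) ∧ Centralizes e (MulAut.conj h '' B) := by
  obtain ⟨e', he', hc'⟩ := hH.exists_centralizing T hB
  obtain ⟨g, hg, hge⟩ := hH.exists_conj_extend (g := 1) hT (hB.subset hAB) he' he
    (hc'.mono hAB) (by simpa using hc)
  refine ⟨g, by simpa using hg, ?_⟩
  rintro x _ ⟨b, hb, rfl⟩
  rw [← hge]
  exact (hc' x b hb).map (MulAut.conj g)

theorem exists_conj_centralizes_finset [Finite T] (hH : IsHallGroup H)
    (hT : Subgroup.center T = ⊥) (w : Finset (T →* H)) (hw : ∀ e ∈ w, Function.Injective e)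
    (hww : ∀ e ∈ w, ∀ e' ∈ w, e ≠ e' → Centralizes e (Set.range e'))
    (hB : B.Finite) (hAB : A ⊆ B) (hc : ∀ e ∈ w, Centralizes e A) :
    ∃ h : H, (∀ a ∈ A, MulAut.conj h a = a) ∧
      ∀ e ∈ w, Centralizes e (MulAut.conj h '' B) := by
  classical
  induction w using Finset.induction_on generalizing A B with
  | empty => exact ⟨1, by simp, by simp⟩
  | insert e w hew ih =>
    simp only [Finset.mem_insert, forall_eq_or_imp] at hw hc
    obtain ⟨h₁, h₁A, h₁B⟩ := hH.exists_conj_centralizes hT hB hAB hw.1 hc.1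
    obtain ⟨h₂, h₂A, h₂B⟩ := ih (A := A ∪ Set.range e)
      (B := MulAut.conj h₁ '' B ∪ Set.range e) hw.2
      (fun e₁ h₁ e₂ h₂ => hww e₁ (Finset.mem_insert_of_mem h₁) e₂ (Finset.mem_insert_of_mem h₂))
      ((hB.image _).union (Set.finite_range e))
      (Set.union_subset_union_left _ fun a ha => ⟨a, hAB ha, h₁A a ha⟩)
      (fun e' he' => (hc.2 e' he').union (hww e' (Finset.mem_insert_of_mem he') e
        (Finset.mem_insert_self _ _) (fun h => hew (h ▸ he'))))
    have hcomp : MulAut.conj (h₂ * h₁) '' B = MulAut.conj h₂ '' (MulAut.conj h₁ '' B) := by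
      rw [Set.image_image, map_mul]
      rfl
    refine ⟨h₂ * h₁, fun a ha => ?_, ?_⟩
    · rw [map_mul, MulAut.mul_apply, h₁A a ha, h₂A a (Or.inl ha)]
    · rw [Finset.forall_mem_insert, hcomp]
      refine ⟨h₁B.conj fun x => ?_, fun e' he' =>
        (h₂B e' he').mono (Set.image_mono Set.subset_union_left)⟩
      have := h₂A (e x) (Or.inr ⟨x, rfl⟩)
      rw [MulAut.conj_apply, mul_inv_eq_iff_eq_mul] at this
      exact this.symm

end IsHallGroup

/-- A finite set of group elements together with finitely many pairwise commuting copies of `T`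
in it. -/
structure CopyCondition (H T : Type) [Group H] [Group T] where
  /-- The underlying finite set. -/
  carrier : Set H
  /-- The copies of `T`. -/
  copies : Finset (T →* H)
  finite : carrier.Finite
  injective : ∀ e ∈ copies, Function.Injective e
  range_subset : ∀ e ∈ copies, Set.range e ⊆ carrier
  centralizes : ∀ e ∈ copies, ∀ e' ∈ copies, e ≠ e' → Centralizes e (Set.range e')

namespace CopyCondition

variable {H T : Type} [Group H] [Group T]

instance : Preorder (CopyCondition H T) where
  le p q := p.carrier ⊆ q.carrier ∧ p.copies ⊆ q.copies ∧
    ∀ e ∈ q.copies, e ∉ p.copies → Centralizes e p.carrier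
  le_refl p := ⟨subset_rfl, subset_rfl, fun _ h h' => absurd h h'⟩
  le_trans p q r hpq hqr := by
    refine ⟨hpq.1.trans hqr.1, hpq.2.1.trans hqr.2.1, fun e he hep => ?_⟩
    by_cases heq : e ∈ q.copies
    · exact hpq.2.2 e heq hep
    · exact (hqr.2.2 e he heq).mono hpq.1

/-- Enlarge the carrier, keeping the copies. -/
def enlarge (p : CopyCondition H T) (B : Set H) (hB : B.Finite) : CopyCondition H T where
  carrier := p.carrier ∪ B
  copies := p.copies
  finite := p.finite.union hB
  injective := p.injective
  range_subset e he := (p.range_subset e he).trans Set.subset_union_left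
  centralizes := p.centralizes

theorem le_enlarge (p : CopyCondition H T) (B : Set H) (hB : B.Finite) : p ≤ p.enlarge B hB :=
  ⟨Set.subset_union_left, subset_rfl, fun _ h h' => absurd h h'⟩

theorem exists_le_card_lt [Finite T] [Nontrivial T] (hH : IsHallGroup H)
    (hT : Subgroup.center T = ⊥) (p : CopyCondition H T) :
    ∃ q, p ≤ q ∧ p.copies.card < q.copies.card := by
  classical
  obtain ⟨e, he, hc⟩ := hH.exists_centralizing T p.finite
  have hep : e ∉ p.copies := by
    intro h
    obtain ⟨t, ht⟩ := exists_ne (1 : T)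
    exact ht (Centralizes.eq_one hT he fun x => hc x _ (p.range_subset e h ⟨t, rfl⟩))
  have hce : ∀ e' ∈ p.copies, Centralizes e (Set.range e') := fun e' he' =>
    hc.mono (p.range_subset e' he')
  refine ⟨⟨p.carrier ∪ Set.range e, insert e p.copies, p.finite.union (Set.finite_range e),
    ?_, ?_, ?_⟩, ⟨Set.subset_union_left, Finset.subset_insert _ _, ?_⟩, ?_⟩
  · rw [Finset.forall_mem_insert]
    exact ⟨he, p.injective⟩
  · rw [Finset.forall_mem_insert]
    exact ⟨Set.subset_union_right,
      fun e he => (p.range_subset e he).trans Set.subset_union_left⟩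
  · intro e₁ h₁ e₂ h₂ hne
    rw [Finset.mem_insert] at h₁ h₂
    rcases h₁ with rfl | h₁ <;> rcases h₂ with rfl | h₂
    · exact absurd rfl hne
    · exact hce _ h₂
    · rintro x _ ⟨y, rfl⟩
      exact (hce _ h₁ y _ ⟨x, rfl⟩).symm
    · exact p.centralizes _ h₁ _ h₂ hne
  · intro e' he' hep'
    rcases Finset.mem_insert.1 he' with rfl | h
    · exact hc
    · exact absurd h hep'
  · rw [Finset.card_insert_of_notMem hep]
    exact Nat.lt_succ_self _

theorem exists_le_card [Finite T] [Nontrivial T] (hH : IsHallGroup H)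
    (hT : Subgroup.center T = ⊥) (p : CopyCondition H T) (n : ℕ) :
    ∃ q, p ≤ q ∧ n ≤ q.copies.card := by
  induction n with
  | zero => exact ⟨p, le_rfl, Nat.zero_le _⟩
  | succ n ih =>
    obtain ⟨q, hpq, hq⟩ := ih
    obtain ⟨r, hqr, hr⟩ := exists_le_card_lt hH hT q
    exact ⟨r, hpq.trans hqr, hq.trans_lt hr⟩

theorem exists_le_conj [Finite T] (hH : IsHallGroup H)
    (hT : Subgroup.center T = ⊥) (p : CopyCondition H T) {A B : Set H} (hB : B.Finite)
    (hAB : A ⊆ B) (u : Set (T →* H)) :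
    ∃ q, p ≤ q ∧ ((∀ e ∈ q.copies, e ∉ u → Centralizes e A) →
      ∃ h : H, MulAut.conj h '' B ⊆ q.carrier ∧ (∀ a ∈ A, MulAut.conj h a = a) ∧
        ∀ e ∈ q.copies, e ∉ u → Centralizes e (MulAut.conj h '' B)) := by
  classical
  by_cases hp : ∀ e ∈ p.copies, e ∉ u → Centralizes e A
  · obtain ⟨h, hA, hc⟩ := hH.exists_conj_centralizes_finset hT (p.copies.filter (· ∉ u))
      (fun e he => p.injective e (Finset.mem_of_mem_filter e he))
      (fun e he e' he' => p.centralizes e (Finset.mem_of_mem_filter e he) e'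
        (Finset.mem_of_mem_filter e' he')) hB hAB
      (fun e he => hp e (Finset.mem_filter.1 he).1 (Finset.mem_filter.1 he).2)
    exact ⟨p.enlarge _ (hB.image (MulAut.conj h)), p.le_enlarge _ _, fun _ =>
      ⟨h, Set.subset_union_right, hA, fun e he heu => hc e (Finset.mem_filter.2 ⟨he, heu⟩)⟩⟩
  · exact ⟨p, le_rfl, fun h => absurd h hp⟩

end CopyCondition

/-- An infinite family of pairwise commuting copies of `T` in `H` over which `H` is
homogeneous. -/
structure IsGenericFamily {H T ι : Type} [Group H] [Group T] (e : ι → T →* H) : Prop where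
  injective : ∀ i, Function.Injective (e i)
  centralizes : ∀ i j, i ≠ j → Centralizes (e i) (Set.range (e j))
  finite : ∀ x : H, {i | ¬ Centralizes (e i) {x}}.Finite
  exists_conj : ∀ A B : Set H, B.Finite → A ⊆ B → ∀ u : Set ι, u.Finite →
    (∀ i ∉ u, Centralizes (e i) A) → ∃ h : H, (∀ a ∈ A, MulAut.conj h a = a) ∧
      ∀ i ∉ u, Centralizes (e i) (MulAut.conj h '' B)

theorem IsHallGroup.exists_isGenericFamily {H T : Type} [Group H] [Countable H] [Group T]
    [Finite T] [Nontrivial T] (hH : IsHallGroup H) (hT : Subgroup.center T = ⊥) :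
    ∃ (ι : Type) (_ : Infinite ι) (e : ι → T →* H), IsGenericFamily e := by
  classical
  have : Countable (T →* H) := DFunLike.coe_injective.countable
  let _ : Encodable H := Encodable.ofCountable H
  let _ : Encodable (T →* H) := Encodable.ofCountable _
  let D : H ⊕ ℕ ⊕ (Finset H × Finset H × Finset (T →* H)) → Set (CopyCondition H T)
    | .inl x => {p | x ∈ p.carrier}
    | .inr (.inl n) => {p | n ≤ p.copies.card}
    | .inr (.inr (A, B, u)) => {p | A ⊆ B → (∀ e ∈ p.copies, e ∉ u → Centralizes e (A : Set H)) →
        ∃ h : H, MulAut.conj h '' B ⊆ p.carrier ∧ (∀ a ∈ A, MulAut.conj h a = a) ∧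
          ∀ e ∈ p.copies, e ∉ u → Centralizes e (MulAut.conj h '' B)}
  have hD : ∀ i, IsCofinal (D i) := by
    rintro (x | n | ⟨A, B, u⟩) p
    · exact ⟨p.enlarge {x} (Set.finite_singleton x), Or.inr rfl, p.le_enlarge _ _⟩
    · obtain ⟨q, h, h'⟩ := p.exists_le_card hH hT n
      exact ⟨q, h', h⟩
    · by_cases hAB : A ⊆ B
      · obtain ⟨q, h, h'⟩ := p.exists_le_conj hH hT B.finite_toSet
          (Finset.coe_subset.2 hAB) (u : Set (T →* H))
        exact ⟨q, fun _ => h', h⟩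
      · exact ⟨p, fun h => absurd h hAB, le_rfl⟩
  let p₀ : CopyCondition H T := ⟨∅, ∅, Set.finite_empty, by simp, by simp, by simp⟩
  let I := Order.idealOfCofinals p₀ fun i => ⟨D i, hD i⟩
  have hI : ∀ i, ∃ p ∈ I, p ∈ D i := fun i => by
    obtain ⟨p, h, h'⟩ := Order.cofinal_meets_idealOfCofinals p₀ (fun i => ⟨D i, hD i⟩) i
    exact ⟨p, h', h⟩
  let S : Set (T →* H) := {e | ∃ p ∈ I, e ∈ p.copies}
  have key : ∀ p ∈ I, ∀ e ∈ S, e ∉ p.copies → Centralizes e p.carrier := by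
    rintro p hp e ⟨q, hq, heq⟩ hep
    obtain ⟨r, -, hpr, hqr⟩ := I.directed p hp q hq
    exact hpr.2.2 e (hqr.2.1 heq) hep
  have hS : S.Infinite := by
    intro hfin
    obtain ⟨p, hp, hcard⟩ := hI (.inr (.inl (hfin.toFinset.card + 1)))
    have : p.copies ⊆ hfin.toFinset := fun e he => hfin.mem_toFinset.2 ⟨p, hp, he⟩
    have := Finset.card_le_card this
    have : hfin.toFinset.card + 1 ≤ p.copies.card := hcard
    omega
  refine ⟨S, hS.to_subtype, Subtype.val, ?_, ?_, ?_, ?_⟩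
  · rintro ⟨e, p, hp, he⟩
    exact p.injective e he
  · rintro ⟨e, p, hp, he⟩ ⟨e', q, hq, he'⟩ hne
    obtain ⟨r, -, hpr, hqr⟩ := I.directed p hp q hq
    exact r.centralizes e (hpr.2.1 he) e' (hqr.2.1 he') fun h => hne (Subtype.ext h)
  · intro x
    obtain ⟨p, hp, hx⟩ := hI (.inl x)
    refine (p.copies.finite_toSet.preimage Subtype.val_injective.injOn).subset ?_
    intro e he
    by_contra hep
    exact he ((key p hp e e.2 hep).mono (Set.singleton_subset_iff.2 hx))
  · intro A B hB hAB u hu hc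
    obtain ⟨p, hp, hd⟩ := hI (.inr (.inr ((hB.subset hAB).toFinset, hB.toFinset,
      (hu.image Subtype.val).toFinset)))
    have hmem : ∀ e : S, (e : T →* H) ∈ (hu.image Subtype.val).toFinset ↔ e ∈ u := by
      intro e
      simp
    obtain ⟨h, hBp, hA, hBc⟩ := hd (by simpa using hAB) (by
      intro e he heu
      rw [Set.Finite.coe_toFinset]
      exact hc ⟨e, p, hp, he⟩ fun h => heu ((hmem ⟨e, p, hp, he⟩).2 h))
    rw [Set.Finite.coe_toFinset] at hBp hBc
    refine ⟨h, fun a ha => hA a (by simpa using ha), fun e he => ?_⟩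
    by_cases hep : (e : T →* H) ∈ p.copies
    · exact hBc e hep fun h => he ((hmem e).1 h)
    · exact (key p hp e e.2 hep).mono hBp

/-- A finite approximation, by conjugation with `conjugator`, to an automorphism inducing the
permutation `σ` of the family `e`. -/
structure PermApprox {H T ι : Type} [Group H] [Group T] (e : ι → T →* H) (σ : Equiv.Perm ι) where
  /-- The domain of the approximation. -/
  carrier : Set H
  /-- The indices whose permutation has been taken care of. -/
  support : Set ι
  /-- The element by which the approximation conjugates. -/
  conjugator : H
  finite_carrier : carrier.Finite
  finite_support : support.Finite
  range_subset : ∀ i ∈ support, Set.range (e i) ⊆ carrier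
  conj_eq : ∀ i ∈ support, ∀ x, MulAut.conj conjugator (e i x) = e (σ i) x
  centralizes : ∀ i ∉ support, Centralizes (e i) carrier
  centralizes_image : ∀ i ∉ support, Centralizes (e (σ i)) (MulAut.conj conjugator '' carrier)

namespace PermApprox

variable {H T ι : Type} [Group H] [Group T] {e : ι → T →* H} {σ : Equiv.Perm ι}

instance : Preorder (PermApprox e σ) where
  le p q := p.carrier ⊆ q.carrier ∧
    ∀ a ∈ p.carrier, MulAut.conj q.conjugator a = MulAut.conj p.conjugator a
  le_refl p := ⟨subset_rfl, fun _ _ => rfl⟩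
  le_trans p q r hpq hqr := ⟨hpq.1.trans hqr.1, fun a ha =>
    (hqr.2 a (hpq.1 ha)).trans (hpq.2 a ha)⟩

/-- The inverse approximation. -/
def symm (p : PermApprox e σ) : PermApprox e σ⁻¹ where
  carrier := MulAut.conj p.conjugator '' p.carrier
  support := σ '' p.support
  conjugator := p.conjugator⁻¹
  finite_carrier := p.finite_carrier.image _
  finite_support := p.finite_support.image _
  range_subset := by
    rintro _ ⟨i, hi, rfl⟩ _ ⟨x, rfl⟩
    exact ⟨e i x, p.range_subset i hi ⟨x, rfl⟩, p.conj_eq i hi x⟩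
  conj_eq := by
    rintro _ ⟨i, hi, rfl⟩ x
    rw [← p.conj_eq i hi]
    simp [mul_assoc]
  centralizes i hi := by
    have := p.centralizes_image (σ⁻¹ i) fun h => hi ⟨_, h, by simp⟩
    simpa using this
  centralizes_image i hi := by
    have := p.centralizes (σ⁻¹ i) fun h => hi ⟨_, h, by simp⟩
    simpa [Set.image_image, mul_assoc] using this

theorem exists_le_mem_support [Finite T] (hH : IsHallGroup H) (hT : Subgroup.center T = ⊥)
    (he : IsGenericFamily e) (p : PermApprox e σ) (i : ι) :
    ∃ q, p ≤ q ∧ p.support ⊆ q.support ∧ i ∈ q.support := by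
  classical
  by_cases hi : i ∈ p.support
  · exact ⟨p, le_rfl, subset_rfl, hi⟩
  obtain ⟨g, hg, hge⟩ := hH.exists_conj_extend hT p.finite_carrier (he.injective i)
    (he.injective (σ i)) (p.centralizes i hi) (p.centralizes_image i hi)
  refine ⟨⟨p.carrier ∪ Set.range (e i), insert i p.support, g,
    p.finite_carrier.union (Set.finite_range _), p.finite_support.insert i, ?_, ?_, ?_, ?_⟩,
    ⟨Set.subset_union_left, hg⟩, Set.subset_insert _ _, Set.mem_insert _ _⟩
  · rintro j (rfl | hj)
    · exact Set.subset_union_right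
    · exact (p.range_subset j hj).trans Set.subset_union_left
  · rintro j (rfl | hj) x
    · exact hge x
    · rw [hg _ (p.range_subset j hj ⟨x, rfl⟩), p.conj_eq j hj]
  · intro j hj
    rw [Set.mem_insert_iff, not_or] at hj
    exact (p.centralizes j hj.2).union (he.centralizes _ _ hj.1)
  · intro j hj
    rw [Set.mem_insert_iff, not_or] at hj
    rw [Set.image_union, Set.image_congr hg, ← Set.range_comp]
    refine (p.centralizes_image j hj.2).union ?_
    have : (MulAut.conj g ∘ e i : T → H) = e (σ i) := funext hge
    rw [this]
    exact he.centralizes _ _ (σ.injective.ne hj.1)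

theorem exists_le_subset_support [Finite T] (hH : IsHallGroup H) (hT : Subgroup.center T = ⊥)
    (he : IsGenericFamily e) (p : PermApprox e σ) {u : Set ι} (hu : u.Finite) :
    ∃ q, p ≤ q ∧ u ⊆ q.support := by
  induction u, hu using Set.Finite.induction_on with
  | empty => exact ⟨p, le_rfl, Set.empty_subset _⟩
  | insert _ _ ih =>
    obtain ⟨q, hpq, hq⟩ := ih
    obtain ⟨r, hqr, hr, hi⟩ := exists_le_mem_support hH hT he q _
    exact ⟨r, hpq.trans hqr, Set.insert_subset hi (hq.trans hr)⟩

theorem exists_le_mem_carrier [Finite T] (hH : IsHallGroup H) (hT : Subgroup.center T = ⊥)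
    (he : IsGenericFamily e) (p : PermApprox e σ) (x : H) :
    ∃ q, p ≤ q ∧ x ∈ q.carrier := by
  obtain ⟨q, hpq, hq⟩ := exists_le_subset_support hH hT he p (he.finite x)
  have hx : ∀ i ∉ q.support, Centralizes (e i) {x} := fun i hi => by
    by_contra h
    exact hi (hq h)
  obtain ⟨h, hA, hB⟩ := he.exists_conj (MulAut.conj q.conjugator '' q.carrier)
    (MulAut.conj q.conjugator '' (q.carrier ∪ {x}))
    ((q.finite_carrier.union (Set.finite_singleton x)).image _)
    (Set.image_mono Set.subset_union_left) (σ '' q.support) (q.finite_support.image _)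
    q.symm.centralizes
  have hA' : ∀ a ∈ q.carrier, MulAut.conj (h * q.conjugator) a = MulAut.conj q.conjugator a := by
    intro a ha
    rw [map_mul, MulAut.mul_apply, hA _ ⟨a, ha, rfl⟩]
  refine ⟨⟨q.carrier ∪ {x}, q.support, h * q.conjugator,
    q.finite_carrier.union (Set.finite_singleton x), q.finite_support, ?_, ?_, ?_, ?_⟩,
    hpq.trans ⟨Set.subset_union_left, hA'⟩, Or.inr rfl⟩
  · exact fun i hi => (q.range_subset i hi).trans Set.subset_union_left
  · intro i hi y
    rw [hA' _ (q.range_subset i hi ⟨y, rfl⟩), q.conj_eq i hi]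
  · exact fun i hi => (q.centralizes i hi).union (hx i hi)
  · intro i hi
    have := hB (σ i) (by simpa using hi)
    rw [Set.image_image] at this
    rw [map_mul]
    exact this

theorem exists_le_mem_image [Finite T] (hH : IsHallGroup H) (hT : Subgroup.center T = ⊥)
    (he : IsGenericFamily e) (p : PermApprox e σ) (x : H) :
    ∃ q, p ≤ q ∧ x ∈ MulAut.conj q.conjugator '' q.carrier := by
  obtain ⟨q, hpq, hq⟩ := exists_le_mem_carrier hH hT he p.symm x
  have hconj : ∀ a ∈ p.carrier,
      MulAut.conj q.conjugator⁻¹ a = MulAut.conj p.conjugator a := by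
    intro a ha
    have h := hpq.2 _ ⟨a, ha, rfl⟩
    have h' : MulAut.conj p.symm.conjugator (MulAut.conj p.conjugator a) = a := by
      simp [symm, mul_assoc]
    rw [h'] at h
    rw [map_inv, MulAut.inv_apply, MulEquiv.symm_apply_eq, h]
  refine ⟨q.symm, ⟨fun a ha => ⟨MulAut.conj p.conjugator a, hpq.1 ⟨a, ha, rfl⟩, ?_⟩, hconj⟩,
    _, ⟨x, hq, rfl⟩, ?_⟩
  · rw [← MulEquiv.eq_symm_apply, ← hconj a ha, map_inv, MulAut.inv_apply]
  · simp [symm, mul_assoc]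

end PermApprox

theorem IsGenericFamily.exists_mulAut {H T ι : Type} [Group H] [Countable H] [Group T]
    [Finite T] (hH : IsHallGroup H) (hT : Subgroup.center T = ⊥) {e : ι → T →* H}
    (he : IsGenericFamily e) (σ : Equiv.Perm ι) :
    ∃ F : MulAut H, ∀ i x, F (e i x) = e (σ i) x := by
  let _ : Encodable H := Encodable.ofCountable H
  let D : H ⊕ H → Set (PermApprox e σ)
    | .inl x => {p | x ∈ p.carrier}
    | .inr x => {p | x ∈ MulAut.conj p.conjugator '' p.carrier}
  have hD : ∀ i, IsCofinal (D i) := by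
    rintro (x | x) p
    · obtain ⟨q, h, h'⟩ := p.exists_le_mem_carrier hH hT he x
      exact ⟨q, h', h⟩
    · obtain ⟨q, h, h'⟩ := p.exists_le_mem_image hH hT he x
      exact ⟨q, h', h⟩
  let p₀ : PermApprox e σ := ⟨∅, ∅, 1, Set.finite_empty, Set.finite_empty, by simp, by simp,
    by simp [Centralizes], by simp [Centralizes]⟩
  let I := Order.idealOfCofinals p₀ fun i => ⟨D i, hD i⟩
  have hI : ∀ i, ∃ p ∈ I, p ∈ D i := fun i => by
    obtain ⟨p, h, h'⟩ := Order.cofinal_meets_idealOfCofinals p₀ (fun i => ⟨D i, hD i⟩) i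
    exact ⟨p, h', h⟩
  choose P hPI hP using fun x => hI (.inl x)
  let f : H → H := fun x => MulAut.conj (P x).conjugator x
  have hf : ∀ q ∈ I, ∀ x ∈ q.carrier, f x = MulAut.conj q.conjugator x := by
    intro q hq x hx
    obtain ⟨r, -, hr, hqr⟩ := I.directed _ (hPI x) q hq
    exact (hr.2 x (hP x)).symm.trans (hqr.2 x hx)
  have hpair : ∀ x y, ∃ q ∈ I, x ∈ q.carrier ∧ y ∈ q.carrier := by
    intro x y
    obtain ⟨r, hr, hxr, hyr⟩ := I.directed _ (hPI x) _ (hPI y)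
    exact ⟨r, hr, hxr.1 (hP x), hyr.1 (hP y)⟩
  have hmul : ∀ x y, f (x * y) = f x * f y := by
    intro x y
    obtain ⟨q, hq, hx, hy⟩ := hpair x y
    obtain ⟨r, hr, hqr, hxyr⟩ := I.directed _ hq _ (hPI (x * y))
    rw [hf r hr x (hqr.1 hx), hf r hr y (hqr.1 hy), hf r hr _ (hxyr.1 (hP _)), map_mul]
  have hinj : Function.Injective f := by
    intro x y hxy
    obtain ⟨q, hq, hx, hy⟩ := hpair x y
    rw [hf q hq x hx, hf q hq y hy] at hxy
    exact (MulAut.conj q.conjugator).injective hxy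
  have hsurj : Function.Surjective f := by
    intro y
    obtain ⟨q, hq, x, hx, hxy⟩ := hI (.inr y)
    exact ⟨x, (hf q hq x hx).trans hxy⟩
  refine ⟨MulEquiv.ofBijective (MonoidHom.mk' f hmul) ⟨hinj, hsurj⟩, fun i x => ?_⟩
  change f (e i x) = _
  by_cases hx : x = 1
  · rw [hx, map_one, map_one]
    exact (MonoidHom.mk' f hmul).map_one
  · have hi : i ∈ (P (e i x)).support := by
      by_contra hi
      exact hx (Centralizes.eq_one hT (he.injective i) fun y =>
        (P (e i x)).centralizes i hi y _ (hP (e i x)))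
    exact (P (e i x)).conj_eq i hi x


/-- **A set of liftable permutations.**
If `H` is Hall's universal group, then there is an infinite subset `S ⊆ H` such that every
permutation of `S` lifts to an automorphism of `H`. -/
theorem exists_infinite_set_with_liftable_permutations
    {H : Type} [Group H] [Countable H]
    (hLF : ∀ s : Finset H, ((Subgroup.closure (s : Set H) : Subgroup H) : Set H).Finite)
    (hEmb : ∀ (G : Type) [Group G] [Finite G], ∃ e : G →* H, Function.Injective e)
    (hHom : ∀ K L : Subgroup H, (K : Set H).Finite → (L : Set H).Finite →
      ∀ φ : ↥K ≃* ↥L, ∃ h : H, ∀ k : K, (φ k : H) = h * (k : H) * h⁻¹) :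
    ∃ S : Set H, S.Infinite ∧
      ∀ σ : Equiv.Perm ↥S, ∃ F : MulAut H, ∀ s : ↥S, F (s : H) = ((σ s : ↥S) : H) := by
  have hH : IsHallGroup H := ⟨hLF, hEmb, hHom⟩
  have hT : Subgroup.center (Equiv.Perm (Fin 3)) = ⊥ := by
    rw [eq_bot_iff]
    intro t ht
    rw [Subgroup.mem_center_iff] at ht
    rw [Subgroup.mem_bot]
    have : ∀ t : Equiv.Perm (Fin 3), (∀ g, g * t = t * g) → t = 1 := by decide
    exact this t ht
  obtain ⟨ι, _, e, he⟩ := hH.exists_isGenericFamily hT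
  obtain ⟨c, hc⟩ := exists_ne (1 : Equiv.Perm (Fin 3))
  have hinj : Function.Injective fun i => e i c := by
    intro i j hij
    by_contra hne
    refine hc (Centralizes.eq_one hT (he.injective i) fun x => ?_)
    exact he.centralizes i j hne x _ ⟨c, hij.symm⟩
  refine ⟨Set.range fun i => e i c, Set.infinite_range_of_injective hinj, fun σ => ?_⟩
  let E := Equiv.ofInjective _ hinj
  obtain ⟨F, hF⟩ := he.exists_mulAut hH hT ((E.trans σ).trans E.symm)
  refine ⟨F, fun s => ?_⟩
  obtain ⟨i, rfl⟩ := E.surjective s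
  have h : e (E.symm (σ (E i))) c = (σ (E i) : H) :=
    congrArg Subtype.val (E.apply_symm_apply (σ (E i)))
  exact (hF i c).trans h
end
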